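/- arXiv:1109.1053 — 7 statements merged into one kernel-verified Lean document; each statement's English description precedes it below -/
import Mathlib

section
/- Let m, n ≥ 1 and let N = n·m. Let g : ℝ^N → ℝ be twice continuously differentiable on an open set containing [0,1]^N, and suppose all second-order partial derivatives of g are bounded in absolute value by M ≥ 0 on [0,1]^N. Let 0 < ε ≤ 1, set δ = ε/(8·m²·n²), and let x, y ∈ [0,1]^N satisfy (y − x) · ∇g(x) ≥ (ε/4)·M. Then g(x + δ·(y − x)) ≥ g(x) + (ε²/(64·m²·n²))·M. -/
open Finset in
/-- Per-iteration progress lemma for the local search allocation rule: for `g` twice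
continuously differentiable on an open set containing the cube `[0,1]^{nm}`, with all
second partial derivatives bounded by `M` on the cube, a step of size `δ = ε/(8m²n²)`
in a direction `y − x` whose inner product with the gradient is at least `(ε/4)·M`
increases `g` by at least `(ε²/(64m²n²))·M`. -/
theorem stmt_1 (m n : ℕ) (hm : 1 ≤ m) (hn : 1 ≤ n)
    (g : (Fin (n * m) → ℝ) → ℝ) (M : ℝ) (hM : 0 ≤ M)
    (U : Set (Fin (n * m) → ℝ)) (hU : IsOpen U)
    (hUsub : Set.Icc (0 : Fin (n * m) → ℝ) 1 ⊆ U)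
    (hg : ContDiffOn ℝ 2 g U)
    (hbound : ∀ z ∈ Set.Icc (0 : Fin (n * m) → ℝ) 1, ∀ e e' : Fin (n * m),
      |fderiv ℝ (fun w => fderiv ℝ g w (Pi.single e 1)) z (Pi.single e' 1)| ≤ M)
    (ε : ℝ) (hε0 : 0 < ε) (hε1 : ε ≤ 1)
    (δ : ℝ) (hδ : δ = ε / (8 * m ^ 2 * n ^ 2))
    (x y : Fin (n * m) → ℝ)
    (hx : x ∈ Set.Icc (0 : Fin (n * m) → ℝ) 1)
    (hy : y ∈ Set.Icc (0 : Fin (n * m) → ℝ) 1)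
    (hgrad : ∑ e : Fin (n * m), (y e - x e) * fderiv ℝ g x (Pi.single e 1) ≥ (ε / 4) * M) :
    g (x + δ • (y - x)) ≥ g x + (ε ^ 2 / (64 * m ^ 2 * n ^ 2)) * M := by
  set v := y - x with hv
  have hvabs : ∀ e, |v e| ≤ 1 := by
    intro e
    have h1 := hx.1 e
    have h2 := hx.2 e
    have h3 := hy.1 e
    have h4 := hy.2 e
    simp only [Pi.zero_apply, Pi.one_apply] at h1 h2 h3 h4
    rw [hv, Pi.sub_apply, abs_le]
    constructor <;> linarith
  have hmem : ∀ t ∈ Set.Icc (0 : ℝ) 1, x + t • v ∈ Set.Icc (0 : Fin (n * m) → ℝ) 1 := by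
    intro t ht
    exact (convex_Icc (0 : Fin (n * m) → ℝ) 1).add_smul_sub_mem hx hy ht
  have hexp : ∀ (L : (Fin (n * m) → ℝ) →L[ℝ] ℝ), L v = ∑ e, v e * L (Pi.single e 1) := by
    intro L
    conv_lhs => rw [pi_eq_sum_univ' v]
    rw [map_sum]
    refine Finset.sum_congr rfl fun e _ => ?_
    rw [map_smul, smul_eq_mul]
  have hline : ∀ t : ℝ, HasDerivAt (fun s : ℝ => x + s • v) v t := by
    intro t
    simpa using ((hasDerivAt_id t).smul_const v).const_add x
  have hgd : ∀ z ∈ U, HasFDerivAt g (fderiv ℝ g z) z := by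
    intro z hz
    exact ((hg.differentiableOn (by norm_num)).differentiableAt (hU.mem_nhds hz)).hasFDerivAt
  have hfd : DifferentiableOn ℝ (fderiv ℝ g) U :=
    (hg.fderiv_of_isOpen hU (m := 1) (by norm_num)).differentiableOn (by norm_num)
  have hFd : ∀ e, ∀ z ∈ U, DifferentiableAt ℝ (fun w => fderiv ℝ g w (Pi.single e 1)) z := by
    intro e z hz
    exact (hfd.differentiableAt (hU.mem_nhds hz)).clm_apply (differentiableAt_const _)
  have hN : (1 : ℝ) ≤ (n : ℝ) * m := by exact_mod_cast Nat.mul_pos hn hm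
  set K : ℝ := (n : ℝ) * m with hK
  have hsum : ∀ (a : Fin (n * m) → ℝ) (B : ℝ), (∀ e, |a e| ≤ B) →
      |∑ e, v e * a e| ≤ K * B := by
    intro a B h
    calc |∑ e, v e * a e| ≤ ∑ e, |v e * a e| := Finset.abs_sum_le_sum_abs _ _
      _ ≤ ∑ e : Fin (n * m), B := by
        refine Finset.sum_le_sum fun e _ => ?_
        rw [abs_mul]
        have := hvabs e
        have := h e
        nlinarith [abs_nonneg (v e), abs_nonneg (a e)]
      _ = K * B := by simp [hK]
  have hF : ∀ e, ∀ t ∈ Set.Icc (0 : ℝ) 1,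
      |fderiv ℝ g (x + t • v) (Pi.single e 1) - fderiv ℝ g x (Pi.single e 1)| ≤ K * M * t := by
    intro e t ht
    have := Convex.norm_image_sub_le_of_norm_hasDerivWithin_le (𝕜 := ℝ)
      (f := fun s : ℝ => fderiv ℝ g (x + s • v) (Pi.single e 1))
      (f' := fun s => fderiv ℝ (fun w => fderiv ℝ g w (Pi.single e 1)) (x + s • v) v)
      (s := Set.Icc (0 : ℝ) 1) (C := K * M) (x := 0) (y := t) ?_ ?_ (convex_Icc 0 1)
      (by simp) ht
    · simpa [abs_of_nonneg ht.1] using this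
    · intro s hs
      exact ((hFd e _ (hUsub (hmem s hs))).hasFDerivAt.comp_hasDerivAt s
        (hline s)).hasDerivWithinAt
    · intro s hs
      rw [hexp, Real.norm_eq_abs]
      exact hsum _ _ fun e' => hbound _ (hmem s hs) e e'
  have hδ' : δ * (8 * K ^ 2) = ε := by
    rw [hδ, hK]
    have : (m : ℝ) ≠ 0 := by positivity
    have : (n : ℝ) ≠ 0 := by positivity
    field_simp
  have hK2 : 1 ≤ K ^ 2 := one_le_pow₀ hN
  have hδ0 : 0 < δ := by
    by_contra h
    nlinarith
  have hδ1 : δ ≤ 1 := by nlinarith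
  have hgt : ∀ t ∈ Set.Icc (0 : ℝ) 1,
      HasDerivAt (fun s : ℝ => g (x + s • v)) (fderiv ℝ g (x + t • v) v) t := fun t ht =>
    (hgd _ (hUsub (hmem t ht))).comp_hasDerivAt t (hline t)
  obtain ⟨c, hc, hceq⟩ := exists_hasDerivAt_eq_slope (fun s : ℝ => g (x + s • v))
    (fun t => fderiv ℝ g (x + t • v) v) hδ0
    (fun t ht => (hgt t ⟨ht.1, ht.2.trans hδ1⟩).continuousAt.continuousWithinAt)
    (fun t ht => hgt t ⟨ht.1.le, ht.2.le.trans hδ1⟩)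
  have hdiff := hsum _ _ fun e => hF e c ⟨hc.1.le, hc.2.le.trans hδ1⟩
  simp only [mul_sub, Finset.sum_sub_distrib] at hdiff
  rw [← hexp] at hdiff
  have hgrad' : ε / 4 * M ≤ ∑ e, v e * fderiv ℝ g x (Pi.single e 1) := hgrad
  have h1 := (abs_le.1 hdiff).1
  have h2 : K * (K * M * c) ≤ ε / 8 * M := by
    have : K * (K * M * c) ≤ K * (K * M * δ) := by
      have := hc.2.le
      gcongr
    rw [← hδ']
    linarith
  have h3 : ε / 8 * M ≤ fderiv ℝ g (x + c • v) v := by linarith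
  have h4 : g (x + δ • v) - g x = δ * fderiv ℝ g (x + c • v) v := by
    rw [hceq]
    simp only [zero_smul, add_zero, sub_zero]
    field_simp
  have h5 : ε ^ 2 / (64 * m ^ 2 * n ^ 2) * M = δ * (ε / 8 * M) := by
    rw [hδ]
    have : (m : ℝ) ≠ 0 := by positivity
    have : (n : ℝ) ≠ 0 := by positivity
    field_simp
    ring
  have h6 := mul_le_mul_of_nonneg_left h3 hδ0.le
  linarith
end

section
/- Let E be a finite set, let f : 2^E → ℝ be submodular with 0 ≤ f(S ∪ {e}) − f(S) ≤ M for every S ⊆ E and e ∈ E, let F be the multilinear extension of f, and define G : ℝ^E → ℝ by G(x) = F(1 − e^{−x_e} : e ∈ E). Then for every x ∈ ℝ^E with all coordinates nonnegative and every pair of coordinates e, e' ∈ E (not necessarily distinct), |∂²G/∂x_e ∂x_{e'} (x)| ≤ M. -/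
/-- The multilinear extension of a set function `f : 2^E → ℝ`:
`F(x) = Σ_{S ⊆ E} f(S) · Π_{e ∈ S} x_e · Π_{e ∉ S} (1 − x_e)`. -/
noncomputable def multilinearExt {E : Type*} [Fintype E] [DecidableEq E]
    (f : Finset E → ℝ) (x : E → ℝ) : ℝ :=
  ∑ S : Finset E, f S * ((∏ e ∈ S, x e) * ∏ e ∈ Sᶜ, (1 - x e))

noncomputable def gExt {E : Type*} [Fintype E] [DecidableEq E]
    (f : Finset E → ℝ) (u : E → ℝ) : ℝ :=
  multilinearExt f (fun a => 1 - Real.exp (-(u a)))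

def dd {E : Type*} [DecidableEq E] (a : E) (f : Finset E → ℝ) (S : Finset E) : ℝ :=
  f (insert a S) - f (S.erase a)

theorem ml_split {E : Type*} [Fintype E] [DecidableEq E] (f : Finset E → ℝ) (a : E) (y : E → ℝ) :
    multilinearExt f y = ∑ S ∈ (Finset.univ.erase a).powerset,
      (f S * (1 - y a) + f (insert a S) * y a) *
        ((∏ e ∈ S, y e) * ∏ e ∈ (Finset.univ.erase a) \ S, (1 - y e)) := by
  unfold multilinearExt
  have h : (Finset.univ : Finset (Finset E)) = (insert a (Finset.univ.erase a)).powerset := by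
    rw [Finset.insert_erase (Finset.mem_univ a), Finset.powerset_univ]
  rw [h, Finset.sum_powerset_insert (Finset.notMem_erase a _), ← Finset.sum_add_distrib]
  refine Finset.sum_congr rfl fun S hS => ?_
  have haS : a ∉ S := fun h => by
    have := Finset.mem_powerset.1 hS h
    simp at this
  have h1 : Sᶜ = insert a (Finset.univ.erase a \ S) := by
    ext b
    by_cases hb : b = a
    · subst hb; simp [haS]
    · simp [hb]
  have h2 : (insert a S)ᶜ = Finset.univ.erase a \ S := by
    ext b; simp
  rw [h2, h1, Finset.prod_insert (by simp), Finset.prod_insert haS]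
  ring

theorem gExt_diff {E : Type*} [Fintype E] [DecidableEq E] (f : Finset E → ℝ) :
    Differentiable ℝ (gExt f) := by
  unfold gExt multilinearExt
  fun_prop

theorem gExt_fderiv {E : Type*} [Fintype E] [DecidableEq E] (f : Finset E → ℝ) (a : E)
    (w : E → ℝ) :
    fderiv ℝ (gExt f) w (Pi.single a 1) = Real.exp (-(w a)) * gExt (dd a f) w := by
  rw [← (gExt_diff f w).lineDeriv_eq_fderiv]
  apply HasLineDerivAt.lineDeriv
  unfold HasLineDerivAt
  have key : (fun t : ℝ => gExt f (w + t • Pi.single a 1)) = fun t =>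
      ∑ S ∈ (Finset.univ.erase a).powerset,
      (f S * (Real.exp (-(w a + t))) + f (insert a S) * (1 - Real.exp (-(w a + t)))) *
        ((∏ e ∈ S, (1 - Real.exp (-(w e)))) *
          ∏ e ∈ (Finset.univ.erase a) \ S, (1 - (1 - Real.exp (-(w e))))) := by
    funext t
    unfold gExt
    rw [ml_split f a]
    refine Finset.sum_congr rfl fun S hS => ?_
    have haS : a ∉ S := fun h => by
      have := Finset.mem_powerset.1 hS h
      simp at this
    have e1 : ∀ b, b ≠ a → (w + t • (Pi.single a 1 : E → ℝ)) b = w b := by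
      intro b hb; simp [hb]
    congr 1
    · simp
    · congr 1
      · refine Finset.prod_congr rfl fun b hb => ?_
        rw [e1 b (fun h => haS (h ▸ hb))]
      · refine Finset.prod_congr rfl fun b hb => ?_
        rw [e1 b (by simp at hb; exact hb.1)]
  rw [key]
  unfold gExt
  rw [ml_split _ a, Finset.mul_sum]
  apply HasDerivAt.fun_sum
  intro S hS
  have haS : a ∉ S := fun h => by
    have := Finset.mem_powerset.1 hS h
    simp at this
  have hE : HasDerivAt (fun t : ℝ => Real.exp (-(w a + t))) (-Real.exp (-(w a))) 0 := by
    have := (((hasDerivAt_id (0:ℝ)).const_add (w a)).fun_neg).exp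
    simpa using this
  have h := (((hE.const_mul (f S)).fun_add ((hE.const_sub 1).const_mul (f (insert a S)))).mul_const
    ((∏ e ∈ S, (1 - Real.exp (-(w e)))) *
          ∏ e ∈ (Finset.univ.erase a) \ S, (1 - (1 - Real.exp (-(w e))))))
  refine h.congr_deriv ?_
  simp only [dd, Finset.insert_idem, Finset.erase_insert haS, Finset.erase_eq_of_notMem haS]
  ring

theorem gExt_bound {E : Type*} [Fintype E] [DecidableEq E] (f : Finset E → ℝ) (M : ℝ)
    (hf : ∀ S, |f S| ≤ M) (x : E → ℝ) (hx : ∀ a, 0 ≤ x a) : |gExt f x| ≤ M := by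
  unfold gExt multilinearExt
  have h0 : ∀ a, 0 ≤ 1 - Real.exp (-(x a)) := fun a => by
    have := Real.exp_le_one_iff.2 (neg_nonpos.2 (hx a)); linarith
  have hs := Finset.prod_add (fun a => 1 - Real.exp (-(x a)))
    (fun a => 1 - (1 - Real.exp (-(x a)))) Finset.univ
  simp only [add_sub_cancel, Finset.prod_const_one, Finset.powerset_univ,
    ← Finset.compl_eq_univ_sdiff] at hs
  refine (Finset.abs_sum_le_sum_abs _ _).trans ?_
  refine le_of_le_of_eq ?_ (mul_one M)
  refine le_of_le_of_eq ?_ (congrArg (fun z => M * z) hs.symm)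
  show _ ≤ M * _
  rw [Finset.mul_sum]
  refine Finset.sum_le_sum fun S _ => ?_
  have hp : 0 ≤ (∏ e ∈ S, (1 - Real.exp (-(x e)))) * ∏ e ∈ Sᶜ, (1 - (1 - Real.exp (-(x e)))) := by
    refine mul_nonneg (Finset.prod_nonneg fun a _ => h0 a) (Finset.prod_nonneg fun a _ => ?_)
    have := Real.exp_pos (-(x a)); linarith
  rw [abs_mul, abs_of_nonneg hp]
  exact mul_le_mul_of_nonneg_right (hf S) hp

/-- For a submodular `f` with all marginal values in `[0, M]`, and
`G(x) = F(1 − e^{−x_e} : e ∈ E)` with `F` the multilinear extension of `f`, every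
second partial derivative of `G` at any point with nonnegative coordinates is bounded
in absolute value by `M`. -/
theorem stmt_6 {E : Type*} [Fintype E] [DecidableEq E] (f : Finset E → ℝ) (M : ℝ)
    (hsub : ∀ S T : Finset E, f (S ∪ T) + f (S ∩ T) ≤ f S + f T)
    (hmarg : ∀ (S : Finset E) (a : E),
      0 ≤ f (insert a S) - f S ∧ f (insert a S) - f S ≤ M)
    (G : (E → ℝ) → ℝ)
    (hG : G = fun u => multilinearExt f (fun a => 1 - Real.exp (-(u a))))
    (x : E → ℝ) (hx : ∀ a : E, 0 ≤ x a) (e e' : E) :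
    |fderiv ℝ (fun w => fderiv ℝ G w (Pi.single e 1)) x (Pi.single e' 1)| ≤ M := by
  have hG' : G = gExt f := hG
  subst hG'
  simp only [gExt_fderiv]
  have hd : ∀ S, 0 ≤ dd e f S ∧ dd e f S ≤ M := fun S => by
    have := hmarg (S.erase e) e
    have h2 : insert e (S.erase e) = insert e S := by
      ext b; by_cases hb : b = e <;> simp [hb]
    rwa [h2] at this
  have hM : 0 ≤ M := (hd ∅).1.trans (hd ∅).2
  have hexp : HasFDerivAt (fun w : E → ℝ => Real.exp (-(w e)))
      (Real.exp (-(x e)) • -(ContinuousLinearMap.proj e : (E → ℝ) →L[ℝ] ℝ)) x :=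
    ((hasFDerivAt_apply (𝕜 := ℝ) e x).fun_neg).exp
  have hle : ∀ a, Real.exp (-(x a)) ≤ 1 := fun a =>
    Real.exp_le_one_iff.2 (neg_nonpos.2 (hx a))
  have hb : ∀ (c b : ℝ), 0 ≤ c → c ≤ 1 → |b| ≤ M → |c * b| ≤ M := fun c b h0 h1 h2 => by
    rw [abs_mul, abs_of_nonneg h0]
    nlinarith [abs_nonneg b]
  rw [(hexp.fun_mul (gExt_diff (dd e f) x).hasFDerivAt).fderiv]
  simp only [add_apply, smul_apply, gExt_fderiv,
    neg_apply, ContinuousLinearMap.proj_apply, smul_eq_mul]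
  by_cases h : e' = e
  · subst h
    have hz : gExt (dd e' (dd e' f)) x = 0 := by
      have hi : ∀ S : Finset E, insert e' (S.erase e') = insert e' S := fun S => by
        ext b; by_cases hb : b = e' <;> simp [hb]
      simp [gExt, multilinearExt, dd, hi]
    rw [hz, Pi.single_eq_same]
    have := hb _ _ (Real.exp_pos _).le (hle e') (gExt_bound (dd e' f) M
      (fun S => abs_le.2 ⟨by linarith [(hd S).1], (hd S).2⟩) x hx)
    rw [← abs_neg] at this
    convert this using 2
    ring
  · rw [Pi.single_eq_of_ne (Ne.symm h)]
    have := hb _ _ (Real.exp_pos _).le (hle e) (hb _ _ (Real.exp_pos _).le (hle e')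
      (gExt_bound (dd e' (dd e f)) M (fun S => by
        have h1 := hd (insert e' S)
        have h2 := hd (S.erase e')
        show |dd e f (insert e' S) - dd e f (S.erase e')| ≤ M
        exact abs_le.2 ⟨by linarith, by linarith⟩) x hx))
    convert this using 2
    ring
end

section
/- Let m ≥ 1 and 1 ≤ k ≤ m. Let E be a ground set of size 2m partitioned into m disjoint pairs e_1, …, e_m (each e_i a 2-element subset of E), and let 𝓕 be any family of k-element subsets of {1, …, m}. Then there exists a matroid on ground set E whose independent sets are exactly the sets S ⊆ E such that |S| < 2k, or |S| = 2k and S is not of the form ⋃_{i ∈ A} e_i for some A ∈ 𝓕. -/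
/-- A matroid on a finite ground set, given by its family of independent sets:
nonempty (contains `∅`), downward closed, and satisfying the exchange axiom. -/
structure FinMatroid (E : Type*) [DecidableEq E] where
  Indep : Finset E → Prop
  empty_indep : Indep ∅
  subset_indep : ∀ ⦃I J : Finset E⦄, Indep J → I ⊆ J → Indep I
  exchange : ∀ ⦃I J : Finset E⦄, Indep I → Indep J → I.card < J.card →
    ∃ x ∈ J \ I, Indep (insert x I)

/-- The paving matroid construction: given a ground set `E` of size `2m` partitioned
into `m` disjoint pairs `e 0, …, e (m−1)` and any family `𝓕` of `k`-element subsets of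
`{0, …, m−1}`, there is a matroid on `E` whose independent sets are exactly the sets `S`
with `|S| < 2k`, or `|S| = 2k` and `S` is not of the form `⋃_{i ∈ A} e i` for `A ∈ 𝓕`. -/
theorem stmt_9 (m k : ℕ) (hm : 1 ≤ m) (hk : 1 ≤ k) (hkm : k ≤ m)
    (E : Type*) [Fintype E] [DecidableEq E] (hE : Fintype.card E = 2 * m)
    (e : Fin m → Finset E) (hpair : ∀ i, (e i).card = 2)
    (hdisj : ∀ i j, i ≠ j → Disjoint (e i) (e j))
    (hcover : Finset.univ.biUnion e = Finset.univ)
    (𝓕 : Finset (Finset (Fin m))) (h𝓕 : ∀ A ∈ 𝓕, A.card = k) :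
    ∃ M : FinMatroid E, ∀ S : Finset E,
      M.Indep S ↔ (S.card < 2 * k ∨
        (S.card = 2 * k ∧ ¬ ∃ A ∈ 𝓕, S = A.biUnion e)) := by
  refine ⟨⟨fun S => S.card < 2 * k ∨ (S.card = 2 * k ∧ ¬ ∃ A ∈ 𝓕, S = A.biUnion e),
    ?_, ?_, ?_⟩, fun S => Iff.rfl⟩
  · left
    simp only [Finset.card_empty]
    omega
  · intro I J hJ hIJ
    rcases eq_or_lt_of_le hIJ with rfl | h
    · exact hJ
    · left
      have := Finset.card_lt_card h
      rcases hJ with hJ | hJ <;> omega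
  · intro I J hI hJ hlt
    obtain ⟨x, hxJ, hxI⟩ := Finset.exists_mem_notMem_of_card_lt_card hlt
    by_contra hcon
    push Not at hcon
    have key : ∀ y ∈ J, y ∉ I → (insert y I).card = 2 * k ∧ J.card = 2 * k ∧
        (¬ ∃ A ∈ 𝓕, J = A.biUnion e) ∧ ∃ A ∈ 𝓕, insert y I = A.biUnion e := by
      intro y hy hyI
      obtain ⟨h1, h2⟩ := hcon y (Finset.mem_sdiff.2 ⟨hy, hyI⟩)
      have hc := Finset.card_insert_of_notMem hyI
      have hJc : J.card = 2 * k := by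
        rcases hJ with hJ | hJ <;> omega
      have hJn : ¬ ∃ A ∈ 𝓕, J = A.biUnion e := by
        rcases hJ with hJ | hJ
        · omega
        · exact hJ.2
      have hc2 : (insert y I).card = 2 * k := by omega
      exact ⟨hc2, hJc, hJn, h2 hc2⟩
    obtain ⟨hc, hJc, hJn, A, hA, hxA⟩ := key x hxJ hxI
    apply hJn
    refine ⟨A, hA, ?_⟩
    rw [← hxA]
    refine Finset.eq_of_subset_of_card_le ?_ (by omega)
    intro y hy
    by_contra hyn
    rw [Finset.mem_insert, not_or] at hyn
    obtain ⟨-, -, -, B, hB, hyB⟩ := key y hy hyn.2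
    have hxm : x ∈ A.biUnion e := hxA ▸ Finset.mem_insert_self x I
    obtain ⟨i, hi, hxi⟩ := Finset.mem_biUnion.1 hxm
    obtain ⟨z, hz, hzx⟩ := Finset.exists_mem_ne (by rw [hpair i]; omega) x (s := e i)
    have hzA : z ∈ insert x I := hxA ▸ Finset.mem_biUnion.2 ⟨i, hi, hz⟩
    have hzI : z ∈ I := (Finset.mem_insert.1 hzA).resolve_left hzx
    have hzB : z ∈ B.biUnion e := hyB ▸ Finset.mem_insert_of_mem hzI
    obtain ⟨j, hj, hzj⟩ := Finset.mem_biUnion.1 hzB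
    have hij : i = j := by
      by_contra hne
      exact Finset.disjoint_left.1 (hdisj i j hne) hz hzj
    subst hij
    have hxB : x ∈ insert y I := hyB ▸ Finset.mem_biUnion.2 ⟨i, hj, hxi⟩
    rcases Finset.mem_insert.1 hxB with h | h
    · exact hyn.1 h.symm
    · exact hxI h
end

section
/- Let m ≥ 1 and 1 ≤ k ≤ m. Let E be a ground set of size 2m partitioned into m disjoint pairs e_1, …, e_m, let 𝓕 be a family of k-element subsets of {1, …, m}, and let 𝓜 be the matroid on E whose independent sets are exactly the sets S ⊆ E such that |S| < 2k, or |S| = 2k and S is not of the form ⋃_{i ∈ A} e_i for some A ∈ 𝓕. Let r denote the rank function of 𝓜. Then for every S ⊆ E: if S = ⋃_{i ∈ A} e_i for some A ∈ 𝓕, then r(S) = 2k − 1; otherwise r(S) = min{|S|, 2k}. -/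
/-- The rank of a set `S`: the maximum cardinality of an independent subset of `S`. -/
noncomputable def FinMatroid.rank {E : Type*} [DecidableEq E]
    (M : FinMatroid E) (S : Finset E) : ℕ :=
  letI := Classical.decPred M.Indep
  (S.powerset.filter M.Indep).sup Finset.card

theorem rank_eq_aux {E : Type*} [DecidableEq E] (M : FinMatroid E) (S : Finset E) (n : ℕ)
    (h1 : ∃ T ⊆ S, M.Indep T ∧ T.card = n) (h2 : ∀ T ⊆ S, M.Indep T → T.card ≤ n) :
    M.rank S = n := by
  classical
  unfold FinMatroid.rank
  apply le_antisymm
  · apply Finset.sup_le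
    intro T hT
    rw [Finset.mem_filter, Finset.mem_powerset] at hT
    exact h2 T hT.1 hT.2
  · obtain ⟨T, hTS, hT, rfl⟩ := h1
    apply Finset.le_sup (f := Finset.card)
    rw [Finset.mem_filter, Finset.mem_powerset]
    exact ⟨hTS, hT⟩

/-- The rank function of the paving matroid: `r(S) = 2k − 1` if `S = ⋃_{i ∈ A} e i`
for some `A ∈ 𝓕`, and `r(S) = min(|S|, 2k)` otherwise. -/
theorem stmt_10 (m k : ℕ) (hm : 1 ≤ m) (hk : 1 ≤ k) (hkm : k ≤ m)
    (E : Type*) [Fintype E] [DecidableEq E] (hE : Fintype.card E = 2 * m)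
    (e : Fin m → Finset E) (hpair : ∀ i, (e i).card = 2)
    (hdisj : ∀ i j, i ≠ j → Disjoint (e i) (e j))
    (hcover : Finset.univ.biUnion e = Finset.univ)
    (𝓕 : Finset (Finset (Fin m))) (h𝓕 : ∀ A ∈ 𝓕, A.card = k)
    (M : FinMatroid E)
    (hM : ∀ S : Finset E, M.Indep S ↔ (S.card < 2 * k ∨
      (S.card = 2 * k ∧ ¬ ∃ A ∈ 𝓕, S = A.biUnion e))) :
    ∀ S : Finset E,
      ((∃ A ∈ 𝓕, S = A.biUnion e) → M.rank S = 2 * k - 1) ∧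
      ((¬ ∃ A ∈ 𝓕, S = A.biUnion e) → M.rank S = min S.card (2 * k)) := by
  intro S
  have hcard : ∀ A ∈ 𝓕, (A.biUnion e).card = 2 * k := by
    intro A hA
    rw [Finset.card_biUnion (fun i _ j _ hij => hdisj i j hij), Finset.sum_congr rfl
      (fun i _ => hpair i), Finset.sum_const, h𝓕 A hA, smul_eq_mul, mul_comm]
  constructor
  · rintro ⟨A, hA, rfl⟩
    have hc := hcard A hA
    apply rank_eq_aux
    · obtain ⟨T, hT, hTc⟩ := Finset.exists_subset_card_eq
        (show 2 * k - 1 ≤ (A.biUnion e).card by omega)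
      exact ⟨T, hT, (hM T).2 (Or.inl (by omega)), hTc⟩
    · intro T hT hI
      rcases (hM T).1 hI with h | ⟨h, h'⟩
      · omega
      · exact absurd ⟨A, hA, Finset.eq_of_subset_of_card_le hT (by omega)⟩ h'
  · intro hS
    apply rank_eq_aux
    · rcases le_or_gt S.card (2 * k) with hle | hgt
      · refine ⟨S, subset_rfl, (hM S).2 ?_, by omega⟩
        rcases hle.lt_or_eq with h | h
        · exact Or.inl h
        · exact Or.inr ⟨h, hS⟩
      · rw [min_eq_right hgt.le]
        obtain ⟨T, hT, hTc⟩ := Finset.exists_subset_card_eq hgt.le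
        by_cases hF : ∃ A ∈ 𝓕, T = A.biUnion e
        · obtain ⟨A, hA, rfl⟩ := hF
          have hAne : A.Nonempty := by
            rw [← Finset.card_pos, h𝓕 A hA]; omega
          obtain ⟨i, hi⟩ := hAne
          obtain ⟨y, z, hyz, hei⟩ := Finset.card_eq_two.1 (hpair i)
          have hy : y ∈ A.biUnion e := Finset.mem_biUnion.2 ⟨i, hi, by simp [hei]⟩
          have hz : z ∈ A.biUnion e := Finset.mem_biUnion.2 ⟨i, hi, by simp [hei]⟩
          obtain ⟨x, hxS, hx⟩ := Finset.exists_mem_notMem_of_card_lt_card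
            (show (A.biUnion e).card < S.card by omega)
          have hc1 : (insert x ((A.biUnion e).erase y)).card = 2 * k := by
            rw [Finset.card_insert_of_notMem (fun h => hx (Finset.mem_of_mem_erase h)),
              Finset.card_erase_of_mem hy]
            omega
          refine ⟨insert x ((A.biUnion e).erase y), ?_, (hM _).2 (Or.inr ⟨hc1, ?_⟩), hc1⟩
          · exact Finset.insert_subset hxS ((Finset.erase_subset _ _).trans hT)
          · rintro ⟨B, hB, hEq⟩
            have hz1 : z ∈ B.biUnion e := by
              rw [← hEq]
              exact Finset.mem_insert_of_mem (Finset.mem_erase.2 ⟨hyz.symm, hz⟩)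
            obtain ⟨j, hj, hzj⟩ := Finset.mem_biUnion.1 hz1
            have hij : i = j := by
              by_contra hne
              exact Finset.disjoint_left.1 (hdisj i j hne) (by simp [hei]) hzj
            subst hij
            have hy1 : y ∈ B.biUnion e := Finset.mem_biUnion.2 ⟨i, hj, by simp [hei]⟩
            rw [← hEq, Finset.mem_insert] at hy1
            rcases hy1 with rfl | h
            · exact hx hy
            · exact (Finset.mem_erase.1 h).1 rfl
        · exact ⟨T, hT, (hM T).2 (Or.inr ⟨hTc, hF⟩), hTc⟩
    · intro T hT hI
      have := Finset.card_le_card hT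
      rcases (hM T).1 hI with h | ⟨h, h'⟩ <;> exact le_min this (by omega)
end

section
/- Let m ≥ 1 and 1 ≤ k ≤ m. Let E be a ground set of size 2m partitioned into m disjoint pairs e_1, …, e_m, let 𝓕 be a family of k-element subsets of {1, …, m}, and let 𝓜 be the matroid on E whose independent sets are exactly the sets S ⊆ E such that |S| < 2k, or |S| = 2k and S is not of the form ⋃_{i ∈ A} e_i for some A ∈ 𝓕. Let r denote the rank function of 𝓜. Then Σ_{S ⊆ E} r(S) = (Σ_{S ⊆ E} min{|S|, 2k}) − |𝓕|. -/
/-- The total rank of all subsets of the ground set of the paving matroid: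
`Σ_{S ⊆ E} r(S) = (Σ_{S ⊆ E} min(|S|, 2k)) − |𝓕|`. -/
theorem stmt_11 (m k : ℕ) (hm : 1 ≤ m) (hk : 1 ≤ k) (hkm : k ≤ m)
    (E : Type*) [Fintype E] [DecidableEq E] (hE : Fintype.card E = 2 * m)
    (e : Fin m → Finset E) (hpair : ∀ i, (e i).card = 2)
    (hdisj : ∀ i j, i ≠ j → Disjoint (e i) (e j))
    (hcover : Finset.univ.biUnion e = Finset.univ)
    (𝓕 : Finset (Finset (Fin m))) (h𝓕 : ∀ A ∈ 𝓕, A.card = k)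
    (M : FinMatroid E)
    (hM : ∀ S : Finset E, M.Indep S ↔ (S.card < 2 * k ∨
      (S.card = 2 * k ∧ ¬ ∃ A ∈ 𝓕, S = A.biUnion e))) :
    (∑ S : Finset E, (M.rank S : ℤ))
      = (∑ S : Finset E, (min S.card (2 * k) : ℤ)) - 𝓕.card := by
  have hcardU : ∀ A : Finset (Fin m), (A.biUnion e).card = 2 * A.card := by
    intro A
    rw [Finset.card_biUnion (fun i _ j _ h => hdisj i j h)]
    simp [hpair, mul_comm]
  have huniq : ∀ x i j, x ∈ e i → x ∈ e j → i = j := by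
    intro x i j hi hj
    by_contra h
    exact Finset.disjoint_left.mp (hdisj i j h) hi hj
  have hinj : Function.Injective (fun A : Finset (Fin m) => A.biUnion e) := by
    have key : ∀ A B : Finset (Fin m), A.biUnion e = B.biUnion e → A ⊆ B := by
      intro A B h i hi
      obtain ⟨x, hx⟩ : (e i).Nonempty := by
        rw [← Finset.card_pos, hpair]; norm_num
      have hxB : x ∈ B.biUnion e := h ▸ Finset.mem_biUnion.mpr ⟨i, hi, hx⟩
      obtain ⟨j, hj, hxj⟩ := Finset.mem_biUnion.mp hxB
      rwa [huniq x i j hx hxj]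
    intro A B h
    exact Finset.Subset.antisymm (key A B h) (key B A h.symm)
  have hle : ∀ (S : Finset E) (n : ℕ), M.rank S ≤ n ↔
      ∀ T ⊆ S, M.Indep T → T.card ≤ n := by
    intro S n
    simp [FinMatroid.rank, Finset.sup_le_iff]
  have hge : ∀ S T : Finset E, T ⊆ S → M.Indep T → T.card ≤ M.rank S :=
    fun S T h1 h2 => (hle S _).mp le_rfl T h1 h2
  have hmain : ∀ S : Finset E, M.rank S +
      (if S ∈ 𝓕.image (fun A => A.biUnion e) then 1 else 0) = min S.card (2 * k) := by
    intro S
    split_ifs with hS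
    · obtain ⟨A, hA, rfl⟩ := Finset.mem_image.mp hS
      have hc := hcardU A
      rw [h𝓕 A hA] at hc
      have h1 : M.rank (A.biUnion e) ≤ 2 * k - 1 := by
        rw [hle]
        intro T hT hI
        rcases (hM T).mp hI with h | ⟨h, hn⟩
        · omega
        · exact absurd ⟨A, hA, Finset.eq_of_subset_of_card_le hT (by omega)⟩ hn
      obtain ⟨T, hT, hTc⟩ := Finset.exists_subset_card_eq
        (s := A.biUnion e) (n := 2 * k - 1) (by omega)
      have h2 := hge _ T hT ((hM T).mpr (Or.inl (by omega)))
      simp only [hc]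
      omega
    · have h1 : M.rank S ≤ min S.card (2 * k) := by
        rw [hle]
        intro T hT hI
        have := Finset.card_le_card hT
        rcases (hM T).mp hI with h | ⟨h, hn⟩ <;> omega
      suffices h : ∃ T ⊆ S, M.Indep T ∧ min S.card (2 * k) ≤ T.card by
        obtain ⟨T, hT, hI, hc⟩ := h
        have := hge S T hT hI
        omega
      rcases lt_trichotomy S.card (2 * k) with h | h | h
      · exact ⟨S, subset_rfl, (hM S).mpr (Or.inl h), by omega⟩
      · refine ⟨S, subset_rfl, (hM S).mpr (Or.inr ⟨h, ?_⟩), by omega⟩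
        rintro ⟨A, hA, rfl⟩
        exact hS (Finset.mem_image.mpr ⟨A, hA, rfl⟩)
      · obtain ⟨T, hT, hTc⟩ := Finset.exists_subset_card_eq (s := S) (n := 2 * k) h.le
        by_cases hI : M.Indep T
        · exact ⟨T, hT, hI, by omega⟩
        · have hex : ∃ A ∈ 𝓕, T = A.biUnion e := by
            by_contra hn
            exact hI ((hM T).mpr (Or.inr ⟨hTc, hn⟩))
          obtain ⟨A, hA, hTA⟩ := hex
          obtain ⟨x, hxS, hxT⟩ := Finset.exists_mem_notMem_of_card_lt_card (by omega : T.card < S.card)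
          obtain ⟨y, hy⟩ : T.Nonempty := by
            rw [← Finset.card_pos]; omega
          have hxy : x ≠ y := fun h => hxT (h ▸ hy)
          have hc : (insert x (T.erase y)).card = 2 * k := by
            rw [Finset.card_insert_of_notMem (fun h => hxT (Finset.mem_of_mem_erase h)),
              Finset.card_erase_of_mem hy]
            omega
          refine ⟨insert x (T.erase y), ?_, (hM _).mpr (Or.inr ⟨hc, ?_⟩), by omega⟩
          · exact Finset.insert_subset hxS ((Finset.erase_subset _ _).trans hT)
          · rintro ⟨B, hB, hTB⟩
            obtain ⟨i, hi, hyi⟩ := Finset.mem_biUnion.mp (hTA ▸ hy)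
            obtain ⟨z, hz, hzy⟩ := Finset.exists_mem_ne
              (by rw [hpair]; norm_num : 1 < (e i).card) y
            have hzT : z ∈ T := hTA ▸ Finset.mem_biUnion.mpr ⟨i, hi, hz⟩
            have hzB : z ∈ B.biUnion e := hTB ▸
              Finset.mem_insert_of_mem (Finset.mem_erase.mpr ⟨hzy, hzT⟩)
            obtain ⟨j, hj, hzj⟩ := Finset.mem_biUnion.mp hzB
            have hij := huniq z i j hz hzj
            subst hij
            have hyB : y ∈ insert x (T.erase y) :=
              hTB ▸ Finset.mem_biUnion.mpr ⟨i, hj, hyi⟩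
            simp [hxy.symm] at hyB
  have hsum : (∑ S : Finset E, M.rank S) + 𝓕.card =
      ∑ S : Finset E, min S.card (2 * k) := by
    rw [← Finset.sum_congr rfl (fun S _ => hmain S), Finset.sum_add_distrib]
    congr 1
    rw [Finset.sum_boole, Finset.filter_univ_mem, Finset.card_image_of_injective _ hinj]
    simp
  have hz : ((∑ S : Finset E, M.rank S : ℕ) : ℤ) + 𝓕.card =
      ((∑ S : Finset E, min S.card (2 * k) : ℕ) : ℤ) := by exact_mod_cast hsum
  push_cast at hz
  linarith
end

section
/- Let G be a finite simple graph with exactly n = 2k vertices (k ≥ 1) and m ≥ k edges, with edges indexed by {1, …, m}. Let 𝓕 be the family of k-element subsets A of {1, …, m} such that the edges indexed by A form a perfect matching of G. Let E be a ground set of size 2m partitioned into m disjoint pairs e_1, …, e_m, and let 𝓜 be the matroid on E whose independent sets are exactly the sets S ⊆ E such that |S| < 2k, or |S| = 2k and S is not of the form ⋃_{i ∈ A} e_i for some A ∈ 𝓕, with rank function r. Then the number of perfect matchings of G equals Σ_{S ⊆ E} (min{|S|, 2k} − r(S)). -/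
theorem aux_le_rank {E : Type*} [DecidableEq E] (M : FinMatroid E) {S T : Finset E}
    (h : T ⊆ S) (hT : M.Indep T) : T.card ≤ M.rank S := by
  classical
  unfold FinMatroid.rank
  apply Finset.le_sup (f := Finset.card)
  simp [h, hT]

theorem aux_rank_le {E : Type*} [DecidableEq E] (M : FinMatroid E) {S : Finset E} {n : ℕ}
    (h : ∀ T ⊆ S, M.Indep T → T.card ≤ n) : M.rank S ≤ n := by
  classical
  unfold FinMatroid.rank
  apply Finset.sup_le
  intro T hT
  simp only [Finset.mem_filter, Finset.mem_powerset] at hT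
  exact h T hT.1 hT.2

theorem aux_card {m k : ℕ} {V : Type*} [Fintype V] [DecidableEq V] (G : SimpleGraph V)
    (hV : Fintype.card V = 2 * k) (f : Fin m → Sym2 V) (hf : ∀ i, f i ∈ G.edgeSet)
    (A : Finset (Fin m)) (h : ∀ v : V, ∃! i : Fin m, i ∈ A ∧ v ∈ f i) : A.card = k := by
  classical
  have h1 : ∑ v : V, (A.filter (fun i => v ∈ f i)).card
      = ∑ i ∈ A, (Finset.univ.filter (fun v => v ∈ f i)).card :=
    Finset.sum_card_bipartiteAbove_eq_sum_card_bipartiteBelow (fun v i => v ∈ f i)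
  have h2 : ∀ v : V, (A.filter (fun i => v ∈ f i)).card = 1 := by
    intro v
    obtain ⟨i, hi, hu⟩ := h v
    rw [Finset.card_eq_one]
    refine ⟨i, ?_⟩
    ext j
    simp only [Finset.mem_filter, Finset.mem_singleton]
    exact ⟨fun hj => hu j hj, fun hj => hj ▸ hi⟩
  have h3 : ∀ i ∈ A, (Finset.univ.filter (fun v => v ∈ f i)).card = 2 := by
    intro i _
    have h4 := Sym2.card_toFinset_of_not_isDiag (f i) (G.not_isDiag_of_mem_edgeSet (hf i))
    rw [← h4]
    congr 1
    ext v
    simp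
  rw [Finset.sum_congr rfl h3, Finset.sum_congr rfl (fun v _ => h2 v)] at h1
  simp at h1
  omega

/-- Embedding counting perfect matchings into computing the total rank of the paving
matroid: for a graph `G` with `2k` vertices and `m` edges indexed by `Fin m`, with `𝓕`
the family of `k`-element index sets forming perfect matchings (a set of edges is a
perfect matching iff every vertex lies in exactly one of its edges), the number of
perfect matchings of `G` equals `Σ_{S ⊆ E} (min(|S|, 2k) − r(S))`. -/
theorem stmt_12 (m k : ℕ) (hk : 1 ≤ k) (hkm : k ≤ m)
    (V : Type*) [Fintype V] [DecidableEq V] (G : SimpleGraph V)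
    (hV : Fintype.card V = 2 * k)
    (edgeIdx : Fin m → Sym2 V) (hinj : Function.Injective edgeIdx)
    (hrange : Set.range edgeIdx = G.edgeSet)
    (𝓕 : Finset (Finset (Fin m)))
    (h𝓕 : ∀ A : Finset (Fin m), A ∈ 𝓕 ↔
      (A.card = k ∧ ∀ v : V, ∃! i : Fin m, i ∈ A ∧ v ∈ edgeIdx i))
    (E : Type*) [Fintype E] [DecidableEq E] (hE : Fintype.card E = 2 * m)
    (e : Fin m → Finset E) (hpair : ∀ i, (e i).card = 2)
    (hdisj : ∀ i j, i ≠ j → Disjoint (e i) (e j))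
    (hcover : Finset.univ.biUnion e = Finset.univ)
    (M : FinMatroid E)
    (hM : ∀ S : Finset E, M.Indep S ↔ (S.card < 2 * k ∨
      (S.card = 2 * k ∧ ¬ ∃ A ∈ 𝓕, S = A.biUnion e))) :
    (Set.ncard {F : Finset (Sym2 V) | ↑F ⊆ G.edgeSet ∧
        ∀ v : V, ∃! s : Sym2 V, s ∈ F ∧ v ∈ s} : ℤ)
      = ∑ S : Finset E, ((min S.card (2 * k) : ℤ) - M.rank S) := by
  classical
  have hne : ∀ i, ∃ x, x ∈ e i := fun i => by
    have : (e i).Nonempty := by rw [← Finset.card_pos, hpair]; norm_num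
    exact this
  have huniq : ∀ i j x, x ∈ e i → x ∈ e j → i = j := by
    intro i j x hi hj
    by_contra hij
    exact Finset.disjoint_left.mp (hdisj i j hij) hi hj
  have hmem : ∀ (A : Finset (Fin m)) i x, x ∈ e i → (x ∈ A.biUnion e ↔ i ∈ A) := by
    intro A i x hx
    simp only [Finset.mem_biUnion]
    constructor
    · rintro ⟨j, hj, hxj⟩
      rwa [huniq i j x hx hxj]
    · exact fun h => ⟨i, h, hx⟩
  have hinjU : Function.Injective (fun A : Finset (Fin m) => A.biUnion e) := by
    intro A B hAB
    ext i
    obtain ⟨x, hx⟩ := hne i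
    rw [← hmem A i x hx, ← hmem B i x hx]
    simp only at hAB
    rw [hAB]
  have hcardU : ∀ A ∈ 𝓕, (A.biUnion e).card = 2 * k := by
    intro A hA
    rw [Finset.card_biUnion (fun i _ j _ hij => hdisj i j hij), Finset.sum_congr rfl (fun i _ => hpair i)]
    simp [((h𝓕 A).1 hA).1, mul_comm]
  have hterm : ∀ S : Finset E, ((min S.card (2 * k) : ℤ) - M.rank S)
      = if S ∈ 𝓕.image (fun A => A.biUnion e) then 1 else 0 := by
    intro S
    have hle : M.rank S ≤ S.card := aux_rank_le M (fun T hT _ => Finset.card_le_card hT)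
    have hle2 : M.rank S ≤ 2 * k := aux_rank_le M (fun T _ hI => by
      rcases (hM T).1 hI with h | h <;> omega)
    by_cases hS : S ∈ 𝓕.image (fun A => A.biUnion e)
    · rw [if_pos hS]
      obtain ⟨A, hA, hAS⟩ := Finset.mem_image.1 hS
      have hc : S.card = 2 * k := by rw [← hAS]; exact hcardU A hA
      have hlt : M.rank S ≤ 2 * k - 1 := aux_rank_le M (fun T hT hI => by
        have hTc := Finset.card_le_card hT
        rcases (hM T).1 hI with h | ⟨h, h'⟩
        · omega
        · exfalso
          have : T = S := Finset.eq_of_subset_of_card_le hT (by omega)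
          exact h' ⟨A, hA, by rw [this]; exact hAS.symm⟩)
      obtain ⟨T, hT, hTc⟩ := Finset.exists_subset_card_eq (show 2 * k - 1 ≤ S.card by omega)
      have := aux_le_rank M hT ((hM T).2 (Or.inl (by omega)))
      omega
    · rw [if_neg hS]
      have hnS : ¬ ∃ A ∈ 𝓕, S = A.biUnion e := by
        rintro ⟨A, hA, h⟩
        exact hS (Finset.mem_image.2 ⟨A, hA, h.symm⟩)
      by_cases hc : S.card ≤ 2 * k
      · have hI : M.Indep S := (hM S).2 (by
          rcases Nat.lt_or_eq_of_le hc with h | h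
          · exact Or.inl h
          · exact Or.inr ⟨h, hnS⟩)
        have := aux_le_rank M (Finset.Subset.refl S) hI
        omega
      · have hex : ∃ T ⊆ S, T.card = 2 * k ∧ M.Indep T := by
          obtain ⟨T, hT, hTc⟩ := Finset.exists_subset_card_eq (show 2 * k ≤ S.card by omega)
          by_cases hTA : ∃ A ∈ 𝓕, T = A.biUnion e
          · obtain ⟨A, hA, hTA⟩ := hTA
            obtain ⟨x, hxS, hxT⟩ : ∃ x ∈ S, x ∉ T :=
              Finset.exists_mem_notMem_of_card_lt_card (by omega)
            obtain ⟨i, hi⟩ : A.Nonempty := by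
              rw [← Finset.card_pos, ((h𝓕 A).1 hA).1]; omega
            obtain ⟨y, y', hyy, hei⟩ := Finset.card_eq_two.1 (hpair i)
            have hy : y ∈ e i := by simp [hei]
            have hy' : y' ∈ e i := by simp [hei]
            have hyT : y ∈ T := by rw [hTA]; exact (hmem A i y hy).2 hi
            have hyT' : y' ∈ T := by rw [hTA]; exact (hmem A i y' hy').2 hi
            have hcc : (insert x (T.erase y)).card = 2 * k := by
              rw [Finset.card_insert_of_notMem (by simp [hxT]), Finset.card_erase_of_mem hyT]
              omega
            refine ⟨insert x (T.erase y), ?_, hcc, (hM _).2 (Or.inr ⟨hcc, ?_⟩)⟩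
            · exact Finset.insert_subset hxS ((Finset.erase_subset _ _).trans hT)
            · rintro ⟨B, hB, hTB⟩
              have h1 : y' ∈ insert x (T.erase y) := by
                simp [hyT', hyy.symm]
              rw [hTB, hmem B i y' hy', ← hmem B i y hy, ← hTB] at h1
              have : y ≠ x := fun h => hxT (h ▸ hyT)
              simp [this] at h1
          · exact ⟨T, hT, hTc, (hM T).2 (Or.inr ⟨hTc, hTA⟩)⟩
        obtain ⟨T, hT, hTc, hI⟩ := hex
        have := aux_le_rank M hT hI
        omega
  rw [Finset.sum_congr rfl (fun S _ => hterm S), Finset.sum_boole]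
  have hfil : (Finset.univ.filter (fun S => S ∈ 𝓕.image (fun A => A.biUnion e)))
      = 𝓕.image (fun A => A.biUnion e) := by ext; simp
  rw [hfil, Finset.card_image_of_injective _ hinjU]
  have hset : {F : Finset (Sym2 V) | ↑F ⊆ G.edgeSet ∧ ∀ v : V, ∃! s : Sym2 V, s ∈ F ∧ v ∈ s}
      = ((𝓕.image (fun A => A.image edgeIdx) : Finset (Finset (Sym2 V))) : Set _) := by
    have key : ∀ A : Finset (Fin m), (∀ v : V, ∃! s : Sym2 V, s ∈ A.image edgeIdx ∧ v ∈ s) ↔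
        ∀ v : V, ∃! i : Fin m, i ∈ A ∧ v ∈ edgeIdx i := by
      intro A
      refine forall_congr' fun v => ?_
      constructor
      · rintro ⟨s, ⟨hs, hv⟩, hu⟩
        obtain ⟨i, hi, rfl⟩ := Finset.mem_image.1 hs
        exact ⟨i, ⟨hi, hv⟩, fun j hj =>
          hinj (hu _ ⟨Finset.mem_image_of_mem _ hj.1, hj.2⟩)⟩
      · rintro ⟨i, ⟨hi, hv⟩, hu⟩
        refine ⟨edgeIdx i, ⟨Finset.mem_image_of_mem _ hi, hv⟩, ?_⟩
        rintro s ⟨hs, hv⟩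
        obtain ⟨j, hj, rfl⟩ := Finset.mem_image.1 hs
        rw [hu j ⟨hj, hv⟩]
    have hf : ∀ i, edgeIdx i ∈ G.edgeSet := fun i => hrange ▸ Set.mem_range_self i
    ext F
    simp only [Set.mem_ofPred_eq, Finset.mem_coe, Finset.mem_image]
    constructor
    · rintro ⟨hF, hv⟩
      obtain ⟨A, rfl⟩ : ∃ A : Finset (Fin m), A.image edgeIdx = F := by
        refine ⟨Finset.univ.filter (fun i => edgeIdx i ∈ F), ?_⟩
        ext s
        simp only [Finset.mem_image, Finset.mem_filter, Finset.mem_univ, true_and]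
        constructor
        · rintro ⟨i, hi, rfl⟩; exact hi
        · intro hs
          have : s ∈ Set.range edgeIdx := hrange ▸ hF hs
          obtain ⟨i, rfl⟩ := this
          exact ⟨i, hs, rfl⟩
      have hA := (key A).1 hv
      exact ⟨A, (h𝓕 A).2 ⟨aux_card G hV edgeIdx hf A hA, hA⟩, rfl⟩
    · rintro ⟨A, hA, rfl⟩
      refine ⟨?_, (key A).2 ((h𝓕 A).1 hA).2⟩
      intro s hs
      obtain ⟨i, _, rfl⟩ := Finset.mem_image.1 (Finset.mem_coe.1 hs)
      exact hf i
  rw [hset, Set.ncard_coe_finset, Finset.card_image_of_injective _ (Finset.image_injective hinj)]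
end

section
/- Let 𝓜 be a matroid on a finite ground set E and let w : E → ℝ≥0 be nonnegative weights. Define the weighted rank function r_w : 2^E → ℝ by r_w(S) = max{ Σ_{e ∈ I} w(e) : I ⊆ S, I independent in 𝓜 }. Then there exist finitely many matroids 𝓜_1, …, 𝓜_t on the ground set E and nonnegative coefficients α_1, …, α_t ≥ 0 such that r_w(S) = Σ_{i=1}^t α_i · r_{𝓜_i}(S) for every S ⊆ E, where r_{𝓜_i} denotes the (unweighted) rank function of 𝓜_i. -/
theorem FinMatroid.card_le_rank {E : Type*} [DecidableEq E] (M : FinMatroid E)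
    {I S : Finset E} (hI : M.Indep I) (h : I ⊆ S) : I.card ≤ M.rank S := by
  classical
  unfold FinMatroid.rank
  exact Finset.le_sup (f := Finset.card) (by simp [hI, h])

theorem FinMatroid.exists_rank {E : Type*} [DecidableEq E] (M : FinMatroid E)
    (S : Finset E) : ∃ K ⊆ S, M.Indep K ∧ K.card = M.rank S := by
  classical
  unfold FinMatroid.rank
  letI := Classical.decPred M.Indep
  obtain ⟨K, hK, h⟩ := Finset.exists_mem_eq_sup (S.powerset.filter M.Indep)
    ⟨∅, by simp [M.empty_indep]⟩ Finset.card
  rw [Finset.mem_filter, Finset.mem_powerset] at hK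
  exact ⟨K, hK.1, hK.2, h.symm⟩

theorem FinMatroid.extend {E : Type*} [DecidableEq E] (M : FinMatroid E)
    {S : Finset E} : ∀ (n : ℕ) (I : Finset E), M.Indep I → I ⊆ S → M.rank S - I.card = n →
      ∃ J, I ⊆ J ∧ J ⊆ S ∧ M.Indep J ∧ J.card = M.rank S := by
  intro n
  induction n with
  | zero =>
    intro I hI hS h
    have := M.card_le_rank hI hS
    exact ⟨I, subset_rfl, hS, hI, by omega⟩
  | succ n ih =>
    intro I hI hS h
    obtain ⟨K, hKS, hK, hc⟩ := M.exists_rank S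
    obtain ⟨x, hx, hxi⟩ := M.exchange hI hK (by omega)
    rw [Finset.mem_sdiff] at hx
    obtain ⟨J, h1, h2, h3, h4⟩ := ih (insert x I) hxi
      (Finset.insert_subset (hKS hx.1) hS)
      (by rw [Finset.card_insert_of_notMem hx.2]; omega)
    exact ⟨J, (Finset.subset_insert x I).trans h1, h2, h3, h4⟩

/-- Restriction to `T` (elements outside `T` become loops). -/
def FinMatroid.restr {E : Type*} [DecidableEq E] (M : FinMatroid E) (T : Finset E) :
    FinMatroid E where
  Indep I := M.Indep I ∧ I ⊆ T
  empty_indep := ⟨M.empty_indep, by simp⟩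
  subset_indep := fun _ _ h h' => ⟨M.subset_indep h.1 h', h'.trans h.2⟩
  exchange := by
    intro I J hI hJ h
    obtain ⟨x, hx, hxi⟩ := M.exchange hI.1 hJ.1 h
    exact ⟨x, hx, hxi, Finset.insert_subset (hJ.2 (Finset.mem_sdiff.1 hx).1) hI.2⟩

theorem FinMatroid.aux {E : Type*} [Fintype E] [DecidableEq E] (M : FinMatroid E) :
    ∀ (n : ℕ) (w : E → ℝ), (∀ a, 0 ≤ w a) → (Finset.univ.filter fun a => 0 < w a).card = n →
    ∃ (t : ℕ) (Ms : Fin t → FinMatroid E) (α : Fin t → ℝ),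
      (∀ i, 0 ≤ α i) ∧
      ∀ S : Finset E, IsGreatest {v : ℝ | ∃ I ⊆ S, M.Indep I ∧ v = ∑ a ∈ I, w a}
        (∑ i, α i * ((Ms i).rank S : ℝ)) := by
  intro n
  induction n using Nat.strong_induction_on with
  | _ n ih =>
  intro w hw hn
  set T := Finset.univ.filter fun a => 0 < w a with hT
  have memT : ∀ a, a ∈ T ↔ 0 < w a := by simp [hT]
  rcases T.eq_empty_or_nonempty with h0 | hne
  · have hz : ∀ a, w a = 0 := by
      intro a
      by_contra h
      have : a ∈ T := (memT a).2 (lt_of_le_of_ne (hw a) (Ne.symm h))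
      simp [h0] at this
    refine ⟨0, Fin.elim0, Fin.elim0, fun i => i.elim0, fun S => ?_⟩
    constructor
    · exact ⟨∅, by simp, M.empty_indep, by simp⟩
    · rintro v ⟨I, -, -, rfl⟩
      simp [hz]
  · obtain ⟨b, hb, hmin⟩ := T.exists_min_image w hne
    have hbpos := (memT b).1 hb
    set w' : E → ℝ := fun a => if a ∈ T then w a - w b else 0 with hw'
    have hw'0 : ∀ a, 0 ≤ w' a := by
      intro a
      simp only [hw']
      split_ifs with h
      · linarith [hmin a h]
      · exact le_rfl
    have hlt : (Finset.univ.filter fun a => 0 < w' a).card < n := by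
      rw [← hn]
      apply Finset.card_lt_card
      rw [Finset.ssubset_iff_of_subset]
      · exact ⟨b, hb, by simp [hw']⟩
      · intro a ha
        by_contra h
        simp [hw', h] at ha
    obtain ⟨t, Ms, α, hα, hS⟩ := ih _ hlt w' hw'0 rfl
    have hsplit : ∀ I : Finset E, ∑ a ∈ I, w a = ∑ a ∈ I, w' a + w b * ((I ∩ T).card : ℝ) := by
      intro I
      have : ∀ a ∈ I, w a = w' a + if a ∈ T then w b else 0 := by
        intro a _
        simp only [hw']
        split_ifs with h
        · ring
        · have := hw a
          have h2 := mt (memT a).2 h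
          linarith
      rw [Finset.sum_congr rfl this, Finset.sum_add_distrib]
      congr 1
      rw [← Finset.sum_filter,
        Finset.filter_mem_eq_inter, Finset.sum_const, nsmul_eq_mul, mul_comm]
    refine ⟨t + 1, Fin.cons (M.restr T) Ms, Fin.cons (w b) α, ?_, fun S => ?_⟩
    · intro i
      refine Fin.cases ?_ ?_ i
      · simpa using hbpos.le
      · intro j; simpa using hα j
    rw [Fin.sum_univ_succ]
    simp only [Fin.cons_zero, Fin.cons_succ]
    obtain ⟨⟨I, hIS, hI, hIe⟩, hub⟩ := hS S
    have hub2 : ∀ J ⊆ S, M.Indep J → ∑ a ∈ J, w a ≤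
        w b * ((M.restr T).rank S : ℝ) + ∑ i, α i * ((Ms i).rank S : ℝ) := by
      intro J hJS hJ
      have h1 : ∑ a ∈ J, w' a ≤ _ := hub ⟨J, hJS, hJ, rfl⟩
      have h2 : (J ∩ T).card ≤ (M.restr T).rank S :=
        (M.restr T).card_le_rank
          ⟨M.subset_indep hJ Finset.inter_subset_left, Finset.inter_subset_right⟩
          (Finset.inter_subset_left.trans hJS)
      have h3 : ((J ∩ T).card : ℝ) ≤ ((M.restr T).rank S : ℝ) := by exact_mod_cast h2
      rw [hsplit]
      nlinarith
    constructor
    · obtain ⟨J, hIJ, hJS, hJ, hJc⟩ := (M.restr T).extend (S := S) _ (I ∩ T)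
        ⟨M.subset_indep hI Finset.inter_subset_left, Finset.inter_subset_right⟩
        (Finset.inter_subset_left.trans hIS) rfl
      refine ⟨J, hJS, hJ.1, le_antisymm ?_ (hub2 J hJS hJ.1)⟩
      rw [hsplit, Finset.inter_eq_left.2 hJ.2, hJc, hIe]
      have h1 : ∑ a ∈ I ∩ T, w' a = ∑ a ∈ I, w' a := by
        apply Finset.sum_subset Finset.inter_subset_left
        intro a ha h
        have : a ∉ T := fun h' => h (Finset.mem_inter.2 ⟨ha, h'⟩)
        simp [hw', this]
      have h2 := Finset.sum_le_sum_of_subset_of_nonneg hIJ (f := w') (fun a _ _ => hw'0 a)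
      linarith
    · rintro v ⟨J, hJS, hJ, rfl⟩
      exact hub2 J hJS hJ


/-- Every weighted matroid rank function (with nonnegative weights `w`), where
`r_w(S) = max { Σ_{e ∈ I} w(e) : I ⊆ S, I independent in 𝓜 }`, is a nonnegative
combination of (unweighted) matroid rank functions. -/
theorem stmt_13 {E : Type*} [Fintype E] [DecidableEq E]
    (M : FinMatroid E) (w : E → ℝ) (hw : ∀ a : E, 0 ≤ w a)
    (rw : Finset E → ℝ)
    (hrw : ∀ S : Finset E, IsGreatest
      {v : ℝ | ∃ I ⊆ S, M.Indep I ∧ v = ∑ a ∈ I, w a} (rw S)) :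
    ∃ (t : ℕ) (Ms : Fin t → FinMatroid E) (α : Fin t → ℝ),
      (∀ i, 0 ≤ α i) ∧
      ∀ S : Finset E, rw S = ∑ i, α i * ((Ms i).rank S : ℝ) := by
  obtain ⟨t, Ms, α, hα, h⟩ := M.aux _ w hw rfl
  exact ⟨t, Ms, α, hα, fun S => (hrw S).unique (h S)⟩
end
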